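/- arXiv:0712.4127 — 6 statements merged into one kernel-verified Lean document; each statement's English description precedes it below -/
import Mathlib

section
/- For every k-linear map α : H* → Hom_k(M,N) that is continuous with respect to the finite topologies, there exists a k-linear map T : M → H⊗N such that α = α_T. -/
open TensorProduct

/-- The finite topology on the space of `k`-linear maps `M → N`: the topology induced
from the product topology on the set of all functions `M → N`, where `N` carries the
discrete topology. -/
def finiteTopology (k M N : Type*) [CommSemiring k] [AddCommMonoid M] [Module k M]
    [AddCommMonoid N] [Module k N] : TopologicalSpace (M →ₗ[k] N) :=
  TopologicalSpace.induced (fun f => (f : M → N))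
    (@Pi.topologicalSpace M (fun _ => N) (fun _ => ⊥))

/-- For a `k`-linear map `T : M → H ⊗ N`, the associated map `α_T : H* → Hom_k(M, N)`,
`α_T(ξ)(u) = (ξ ⊗ id_N)(T u)`. -/
noncomputable def alphaT {k H M N : Type*} [Field k] [AddCommGroup H] [Module k H]
    [AddCommGroup M] [Module k M] [AddCommGroup N] [Module k N]
    (T : M →ₗ[k] H ⊗[k] N) (ξ : H →ₗ[k] k) : M →ₗ[k] N :=
  (TensorProduct.lid k N).toLinearMap ∘ₗ (TensorProduct.map ξ LinearMap.id) ∘ₗ T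

/-- An open neighbourhood of `0` in the finite topology contains all linear maps vanishing on
some finite set. -/
theorem exists_finset_of_isOpen_finiteTopology {k M N : Type*} [CommSemiring k]
    [AddCommMonoid M] [Module k M] [AddCommMonoid N] [Module k N] {S : Set (M →ₗ[k] N)}
    (hS : @IsOpen _ (finiteTopology k M N) S) (h0 : 0 ∈ S) :
    ∃ F : Finset M, ∀ f : M →ₗ[k] N, (∀ x ∈ F, f x = 0) → f ∈ S := by
  let _ : TopologicalSpace N := ⊥
  obtain ⟨U, hU, rfl⟩ := isOpen_induced_iff.mp hS
  obtain ⟨F, V, hV, hVU⟩ := isOpen_pi_iff.mp hU _ h0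
  refine ⟨F, fun f hf => hVU fun x hx => ?_⟩
  simpa [hf x hx] using (hV x hx).2

/-- The linear maps killing a given vector form an open set in the finite topology. -/
theorem isOpen_finiteTopology_setOf_apply_eq_zero {k M N : Type*} [CommSemiring k]
    [AddCommMonoid M] [Module k M] [AddCommMonoid N] [Module k N] (u : M) :
    @IsOpen _ (finiteTopology k M N) {f : M →ₗ[k] N | f u = 0} := by
  let _ : TopologicalSpace N := ⊥
  have : DiscreteTopology N := ⟨rfl⟩
  exact isOpen_induced_iff.mpr
    ⟨(fun f : M → N => f u) ⁻¹' {0}, (isOpen_discrete _).preimage (continuous_apply u), rfl⟩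

/-- A linear map out of the dual of `H` that kills the annihilator of a finite set is
contraction with a tensor. -/
theorem exists_tensor_of_vanishing {k H N : Type*} [Field k] [AddCommGroup H] [Module k H]
    [AddCommGroup N] [Module k N] (φ : (H →ₗ[k] k) →ₗ[k] N) (F : Finset H)
    (hF : ∀ ξ : H →ₗ[k] k, (∀ x ∈ F, ξ x = 0) → φ ξ = 0) :
    ∃ t : H ⊗[k] N, ∀ ξ : H →ₗ[k] k,
      φ ξ = TensorProduct.lid k N (TensorProduct.map ξ LinearMap.id t) := by
  let V := Submodule.span k (F : Set H)
  obtain ⟨π, hπ⟩ := V.subtype.exists_leftInverse_of_injective V.ker_subtype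
  let b := Module.finBasis k V
  refine ⟨∑ i, (b i : H) ⊗ₜ[k] φ (b.coord i ∘ₗ π), fun ξ => ?_⟩
  have key : φ (ξ - ∑ i, ξ (b i) • (b.coord i ∘ₗ π)) = 0 := by
    refine hF _ fun x hx => ?_
    let y : V := ⟨x, Submodule.subset_span hx⟩
    have hy : π x = y := LinearMap.congr_fun hπ y
    have hsum : ξ x = ∑ i, b.repr y i * ξ (b i) := by
      calc ξ x = (ξ ∘ₗ V.subtype) (∑ i, b.repr y i • b i) := by rw [b.sum_repr]; rfl
        _ = _ := by simp only [map_sum, map_smul, LinearMap.comp_apply, V.subtype_apply,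
          smul_eq_mul]
    simp [hy, hsum, mul_comm]
  rw [map_sub, sub_eq_zero] at key
  simp [key]

/-- For every `k`-linear map `α : H* → Hom_k(M,N)` that is continuous with respect to the
finite topologies, there exists a `k`-linear map `T : M → H ⊗ N` such that `α = α_T`. -/
theorem stmt1 (k H M N : Type*) [Field k] [AddCommGroup H] [Module k H]
    [AddCommGroup M] [Module k M] [AddCommGroup N] [Module k N]
    (α : (H →ₗ[k] k) → (M →ₗ[k] N))
    (hlin : IsLinearMap k α)
    (hcont : @Continuous _ _ (finiteTopology k H k) (finiteTopology k M N) α) :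
    ∃ T : M →ₗ[k] H ⊗[k] N, ∀ ξ : H →ₗ[k] k, α ξ = alphaT T ξ := by
  have hlocal : ∀ u : M, ∃ t : H ⊗[k] N, ∀ ξ : H →ₗ[k] k,
      α ξ u = TensorProduct.lid k N (TensorProduct.map ξ LinearMap.id t) := by
    intro u
    obtain ⟨F, hF⟩ := exists_finset_of_isOpen_finiteTopology
      ((@continuous_def _ _ (_) (_) _).mp hcont _ (isOpen_finiteTopology_setOf_apply_eq_zero u))
      (by simp [hlin.map_zero])
    exact exists_tensor_of_vanishing (LinearMap.applyₗ u ∘ₗ hlin.mk' α) F hF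
  choose t ht using hlocal
  let b := Module.Basis.ofVectorSpace k M
  refine ⟨b.constr k fun i => t (b i), fun ξ => b.ext fun i => ?_⟩
  simp [alphaT, ht]
end

section
/- For all a, b ∈ Cend^{G,V}M and every g ∈ G, the map a∘_g b belongs to Cend^{G,V}M (it is locally regular and translation invariant). Moreover, there exist finitely many h₁,…,h_r ∈ H and c₁,…,c_r ∈ Cend^{G,V}M such that a∘_g b = Σᵢ hᵢ(g)·cᵢ simultaneously for every g ∈ G. Furthermore these products are associative in the conformal sense: a∘_g(b∘_γ c) = (a∘_g b)∘_{γg} c for all a,b,c ∈ Cend^{G,V}M and g,γ ∈ G. -/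
open TensorProduct

noncomputable section

variable (k : Type) [Field k]
variable (H : Type) [CommRing H] [HopfAlgebra k H]

/-- Convolution product on the set `G` of `k`-algebra homomorphisms `H → k`:
`(g₁g₂)(h) = Σ g₁(h₍₁₎) · g₂(h₍₂₎)`. -/
def conv (g₁ g₂ : H →ₐ[k] k) : H →ₐ[k] k :=
  (Algebra.TensorProduct.lift g₁ g₂ fun _ _ => Commute.all _ _).comp
    (Bialgebra.comulAlgHom k H)

variable (A : Type) [CommRing A] [Algebra k A]
variable (ΔA : A →ₐ[k] H ⊗[k] A)

/-- The left shift on a comodule algebra: `L_g f = Σ f₍₁₎(g) · f₍₂₎`. -/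
def lshiftA (g : H →ₐ[k] k) : A →ₗ[k] A :=
  (TensorProduct.lid k A).toLinearMap ∘ₗ
    (TensorProduct.map g.toLinearMap LinearMap.id) ∘ₗ ΔA.toLinearMap

variable (M : Type) [AddCommGroup M] [Module k M] [Module A M] [IsScalarTower k A M]

/-- `a : G → End_k M` is locally regular if for every `u` the function `g ↦ a(g)u`
is a regular `M`-valued function, i.e. is given by an element `w ∈ H ⊗ M`. -/
def IsLocallyRegular (a : (H →ₐ[k] k) → Module.End k M) : Prop :=
  ∀ u : M, ∃ w : H ⊗[k] M, ∀ g : H →ₐ[k] k,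
    a g u = (TensorProduct.lid k M) (TensorProduct.map g.toLinearMap LinearMap.id w)

/-- Translation invariance: `a(g)(f • u) = (L_g f) • a(g)u`. -/
def IsTransInv (a : (H →ₐ[k] k) → Module.End k M) : Prop :=
  ∀ (g : H →ₐ[k] k) (f : A) (u : M), a g (f • u) = (lshiftA k H A ΔA g f) • (a g u)

/-- Membership in `Cend^{G,V} M`. -/
def MemCend (a : (H →ₐ[k] k) → Module.End k M) : Prop :=
  IsLocallyRegular k H M a ∧ IsTransInv k H A ΔA M a

/-- `(a ∘_g b)(z) = a(g) ∘ b(z g⁻¹)`, where `gi` plays the role of `g⁻¹`. -/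
def compCendM (g gi : H →ₐ[k] k) (a b : (H →ₐ[k] k) → Module.End k M) :
    (H →ₐ[k] k) → Module.End k M :=
  fun z => (a g) ∘ₗ (b (conv k H z gi))

/-- Finitely many evaluation points determine all the evaluations of a finite-dimensional space. -/
theorem exists_interpolation {k X E : Type*} [Field k] [AddCommGroup E] [Module k E]
    [FiniteDimensional k E] (ev : X → Module.Dual k E) :
    ∃ (r : ℕ) (p : Fin r → X) (φ : Fin r → E),
      ∀ (v : E) (x : X), ev x v = ∑ i, ev (p i) v * ev x (φ i) := by
  obtain ⟨f, hf, hspan, -⟩ := Submodule.exists_fun_fin_finrank_span_eq k (Set.range ev)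
  choose p hp using hf
  let R : E →ₗ[k] (Fin _ → k) := LinearMap.pi f
  obtain ⟨s, hs⟩ := R.rangeRestrict.exists_rightInverse_of_surjective R.range_rangeRestrict
  obtain ⟨P, hP⟩ := s.exists_extend
  have hRP (v : E) : R (P (R v)) = R v := by
    have h₁ : P (R v) = s (R.rangeRestrict v) := LinearMap.congr_fun hP (R.rangeRestrict v)
    have h₂ := congrArg Subtype.val (LinearMap.congr_fun hs (R.rangeRestrict v))
    rw [h₁]
    exact h₂
  refine ⟨_, p, fun i => P fun j => if i = j then 1 else 0, fun v x => ?_⟩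
  have key : ∀ ξ ∈ Submodule.span k (Set.range f), ξ (P (R v)) = ξ v := by
    intro ξ hξ
    induction hξ using Submodule.span_induction with
    | mem ξ hξ =>
      obtain ⟨i, rfl⟩ := hξ
      exact congrFun (hRP v) i
    | zero => rfl
    | add ξ η _ _ h₁ h₂ => simp [h₁, h₂]
    | smul c ξ _ h => simp [h]
  have hx : ev x ∈ Submodule.span k (Set.range f) := by
    rw [hspan]
    exact Submodule.subset_span (Set.mem_range_self x)
  rw [← key (ev x) hx, LinearMap.pi_apply_eq_sum_univ P (R v)]
  simp [R, hp]

section Group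

variable {k H}

theorem conv_comul_apply (g₁ g₂ : H →ₐ[k] k) (h : H) :
    conv k H g₁ g₂ h =
      LinearMap.mul' k k (TensorProduct.map g₁.toLinearMap g₂.toLinearMap
        (Coalgebra.comul (R := k) h)) := by
  change Algebra.TensorProduct.lift g₁ g₂ (fun _ _ => Commute.all _ _)
    (Coalgebra.comul (R := k) h) = _
  induction Coalgebra.comul (R := k) h with
  | zero => simp
  | tmul x y => simp
  | add x y hx hy => simp only [map_add, hx, hy]

theorem toConv_conv (g₁ g₂ : H →ₐ[k] k) :
    WithConv.toConv (conv k H g₁ g₂) = WithConv.toConv g₁ * WithConv.toConv g₂ := by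
  apply WithConv.ofConv_injective
  ext h
  exact (AlgHom.convMul_apply (WithConv.toConv g₁) (WithConv.toConv g₂) h).symm

theorem toConv_eq_inv {g gi : H →ₐ[k] k}
    (h : ∀ x : H, gi x = g (HopfAlgebra.antipode (R := k) x)) :
    WithConv.toConv gi = (WithConv.toConv g)⁻¹ := by
  apply WithConv.ofConv_injective
  ext x
  exact h x

theorem conv_conv_inv_cancel {g gi : H →ₐ[k] k}
    (h : ∀ x : H, gi x = g (HopfAlgebra.antipode (R := k) x)) (z : H →ₐ[k] k) :
    conv k H (conv k H z gi) g = z := by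
  apply WithConv.toConv_injective
  simp [toConv_conv, toConv_eq_inv h]

variable (k H) in
/-- The right shift `h ↦ Σ h₍₁₎ · h₍₂₎(g)`. -/
def rshift (g : H →ₐ[k] k) : H →ₗ[k] H :=
  (TensorProduct.rid k H).toLinearMap ∘ₗ
    (TensorProduct.map LinearMap.id g.toLinearMap) ∘ₗ Coalgebra.comul

theorem apply_rshift (z g : H →ₐ[k] k) (h : H) : z (rshift k H g h) = conv k H z g h := by
  rw [conv_comul_apply]
  simp only [rshift, LinearMap.comp_apply]
  induction Coalgebra.comul (R := k) h with
  | zero => simp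
  | tmul x y => simp [mul_comm]
  | add x y hx hy => simp only [map_add, hx, hy]

end Group

section Comodule

variable {k H A ΔA}

theorem lshiftA_lshiftA
    (hcoassoc : ∀ a : A,
      (TensorProduct.assoc k H H A)
          ((TensorProduct.map Coalgebra.comul LinearMap.id) (ΔA a)) =
        (TensorProduct.map LinearMap.id ΔA.toLinearMap) (ΔA a))
    (g₁ g₂ : H →ₐ[k] k) (f : A) :
    lshiftA k H A ΔA g₁ (lshiftA k H A ΔA g₂ f) = lshiftA k H A ΔA (conv k H g₂ g₁) f := by
  let Ψ : H ⊗[k] (H ⊗[k] A) →ₗ[k] A :=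
    (TensorProduct.lid k A).toLinearMap ∘ₗ TensorProduct.map g₂.toLinearMap
      ((TensorProduct.lid k A).toLinearMap ∘ₗ TensorProduct.map g₁.toLinearMap LinearMap.id)
  have h₁ (t : H ⊗[k] A) :
      lshiftA k H A ΔA g₁ (TensorProduct.lid k A
        (TensorProduct.map g₂.toLinearMap LinearMap.id t)) =
      Ψ (TensorProduct.map LinearMap.id ΔA.toLinearMap t) := by
    induction t with
    | zero => simp
    | tmul x y => simp [Ψ, lshiftA]
    | add x y hx hy => simp only [map_add, hx, hy]
  have h₂ (t : H ⊗[k] A) :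
      Ψ (TensorProduct.assoc k H H A (TensorProduct.map Coalgebra.comul LinearMap.id t)) =
      TensorProduct.lid k A
        (TensorProduct.map (conv k H g₂ g₁).toLinearMap LinearMap.id t) := by
    induction t with
    | zero => simp
    | tmul x y =>
      simp only [TensorProduct.map_tmul, AlgHom.toLinearMap_apply, conv_comul_apply]
      induction Coalgebra.comul (R := k) x with
      | zero => simp
      | tmul u v => simp [Ψ, mul_smul, smul_comm (g₁ v)]
      | add u v hu hv => simp only [map_add, TensorProduct.add_tmul, hu, hv]
    | add x y hx hy => simp only [map_add, hx, hy]
  exact (h₁ (ΔA f)).trans (((congrArg Ψ (hcoassoc f)).symm).trans (h₂ (ΔA f)))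

end Comodule

section Cend

variable {k H M}

theorem IsLocallyRegular.compCendM {a b : (H →ₐ[k] k) → Module.End k M}
    (hb : IsLocallyRegular k H M b) (g gi : H →ₐ[k] k) :
    IsLocallyRegular k H M (compCendM k H M g gi a b) := by
  intro u
  obtain ⟨w, hw⟩ := hb u
  refine ⟨TensorProduct.map (rshift k H gi) (a g) w, fun z => ?_⟩
  simp only [_root_.compCendM, LinearMap.comp_apply, hw]
  clear hw
  induction w with
  | zero => simp
  | tmul x y => simp [apply_rshift]
  | add x y hx hy => simp only [map_add, hx, hy]

variable {A ΔA} in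
theorem MemCend.compCendM
    (hcoassoc : ∀ a : A,
      (TensorProduct.assoc k H H A)
          ((TensorProduct.map Coalgebra.comul LinearMap.id) (ΔA a)) =
        (TensorProduct.map LinearMap.id ΔA.toLinearMap) (ΔA a))
    {a b : (H →ₐ[k] k) → Module.End k M}
    (ha : MemCend k H A ΔA M a) (hb : MemCend k H A ΔA M b) {g gi : H →ₐ[k] k}
    (hg : ∀ h : H, gi h = g (HopfAlgebra.antipode (R := k) h)) :
    MemCend k H A ΔA M (compCendM k H M g gi a b) := by
  refine ⟨hb.1.compCendM g gi, fun z f u => ?_⟩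
  simp only [_root_.compCendM, LinearMap.comp_apply]
  rw [hb.2, ha.2, lshiftA_lshiftA hcoassoc, conv_conv_inv_cancel hg]

variable (k H M) in
/-- The regular `M`-valued functions on `G` whose coefficients lie in the subspace `T` of `H`. -/
def regularFun (T : Submodule k H) : Submodule k ((H →ₐ[k] k) → M) :=
  Submodule.span k {f | ∃ h ∈ T, ∃ m : M, f = fun g => g h • m}

theorem smul_mem_regularFun {T : Submodule k H} {h : H} (hh : h ∈ T) (m : M) :
    (fun g : H →ₐ[k] k => g h • m) ∈ regularFun k H M T :=
  Submodule.subset_span ⟨h, hh, m, rfl⟩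

theorem regularFun_mono {T T' : Submodule k H} (h : T ≤ T') :
    regularFun k H M T ≤ regularFun k H M T' :=
  Submodule.span_mono fun _ ⟨x, hx, hf⟩ => ⟨x, h hx, hf⟩

theorem exists_interpolation_regularFun {T : Submodule k H} (hT : T.FG) :
    ∃ (r : ℕ) (p : Fin r → (H →ₐ[k] k)) (φ : Fin r → H),
      ∀ f ∈ regularFun k H M T, ∀ g, f g = ∑ i, g (φ i) • f (p i) := by
  have : FiniteDimensional k T := Module.Finite.iff_fg.mpr hT
  obtain ⟨r, p, φ, hφ⟩ :=
    exists_interpolation fun g : H →ₐ[k] k => g.toLinearMap ∘ₗ T.subtype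
  refine ⟨r, p, fun i => φ i, fun f hf => ?_⟩
  induction hf using Submodule.span_induction with
  | mem f hf =>
    obtain ⟨h, hh, m, rfl⟩ := hf
    intro g
    have := hφ ⟨h, hh⟩ g
    simp only [LinearMap.comp_apply, Submodule.subtype_apply, AlgHom.toLinearMap_apply] at this
    simp only [this, Finset.sum_smul, smul_smul, mul_comm]
  | zero => simp
  | add f f' _ _ h₁ h₂ =>
    intro g
    simp only [Pi.add_apply, smul_add, Finset.sum_add_distrib, ← h₁, ← h₂]
  | smul c f _ h =>
    intro g
    simp only [Pi.smul_apply, smul_comm _ c, ← Finset.smul_sum, ← h]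

/-- A family of functions on `G` that are regular with coefficients in a common finite-dimensional
subspace of `H`. -/
def IsUniformlyRegular {Z : Type*} (F : Z → (H →ₐ[k] k) → M) : Prop :=
  ∃ T : Submodule k H, T.FG ∧ ∀ z, F z ∈ regularFun k H M T

theorem IsUniformlyRegular.add {Z : Type*} {F F' : Z → (H →ₐ[k] k) → M}
    (h : IsUniformlyRegular F) (h' : IsUniformlyRegular F') :
    IsUniformlyRegular fun z g => F z g + F' z g := by
  obtain ⟨T, hT, hF⟩ := h
  obtain ⟨T', hT', hF'⟩ := h'
  exact ⟨T ⊔ T', hT.sup hT', fun z => add_mem (regularFun_mono le_sup_left (hF z))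
    (regularFun_mono le_sup_right (hF' z))⟩

theorem isUniformlyRegular_zero {Z : Type*} :
    IsUniformlyRegular fun (_ : Z) (_ : H →ₐ[k] k) => (0 : M) :=
  ⟨⊥, Submodule.fg_bot, fun _ => zero_mem _⟩

theorem isUniformlyRegular_smul_smul {Z : Type*} (c : Z → k) (h : H) (m : M) :
    IsUniformlyRegular fun z (g : H →ₐ[k] k) => g h • c z • m :=
  ⟨Submodule.span k {h}, Submodule.fg_span_singleton h, fun z =>
    smul_mem_regularFun (Submodule.mem_span_singleton_self h) (c z • m)⟩

theorem isUniformlyRegular_comp {a b : (H →ₐ[k] k) → Module.End k M}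
    (ha : IsLocallyRegular k H M a) (hb : IsLocallyRegular k H M b) (u : M) :
    IsUniformlyRegular fun z g : H →ₐ[k] k =>
      a g (b (conv k H z (g.comp (HopfAlgebra.antipodeAlgHom k H))) u) := by
  obtain ⟨w, hw⟩ := hb u
  simp only [hw]
  clear hw
  induction w with
  | zero => simpa using isUniformlyRegular_zero
  | add x y hx hy => simpa only [map_add] using hx.add hy
  | tmul p v =>
    obtain ⟨w', hw'⟩ := ha v
    simp only [TensorProduct.map_tmul, TensorProduct.lid_tmul, LinearMap.id_apply, map_smul, hw',
      AlgHom.toLinearMap_apply, conv_comul_apply]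
    clear hw'
    induction Coalgebra.comul (R := k) p with
    | zero => simpa using isUniformlyRegular_zero
    | add x y hx hy => simpa only [map_add, add_smul] using hx.add hy
    | tmul x y =>
      induction w' with
      | zero => simpa using isUniformlyRegular_zero
      | add s t hs ht => simpa only [map_add, smul_add] using hs.add ht
      | tmul q m =>
        convert isUniformlyRegular_smul_smul (fun z : H →ₐ[k] k => z x)
          (HopfAlgebra.antipode (R := k) y * q) m using 3 with z g
        simp [smul_smul, mul_comm, mul_left_comm]

end Cend

/-- For all `a, b ∈ Cend^{G,V}M` and every `g ∈ G`, the map `a∘_g b` belongs to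
`Cend^{G,V}M`; moreover there exist finitely many `hᵢ ∈ H`, `cᵢ ∈ Cend^{G,V}M` with
`a∘_g b = Σᵢ hᵢ(g)·cᵢ` simultaneously for every `g ∈ G`; and the products are
associative in the conformal sense: `a∘_g(b∘_γ c) = (a∘_g b)∘_{γg} c`. -/
theorem stmt3 [IsAlgClosed k] [CharZero k]
    [Algebra.FiniteType k H] [IsReduced H]
    [Algebra.FiniteType k A] [IsReduced A] [Module.Finite A M]
    (hcoassoc : ∀ a : A,
      (TensorProduct.assoc k H H A)
          ((TensorProduct.map Coalgebra.comul LinearMap.id) (ΔA a)) =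
        (TensorProduct.map LinearMap.id ΔA.toLinearMap) (ΔA a))
    (hcounit : ∀ a : A,
      (TensorProduct.lid k A)
          ((TensorProduct.map Coalgebra.counit LinearMap.id) (ΔA a)) = a) :
    (∀ a b : (H →ₐ[k] k) → Module.End k M,
      MemCend k H A ΔA M a → MemCend k H A ΔA M b →
      (∀ g gi : H →ₐ[k] k, (∀ h : H, gi h = g (HopfAlgebra.antipode (R := k) h)) →
        MemCend k H A ΔA M (compCendM k H M g gi a b)) ∧
      (∃ (r : ℕ) (hs : Fin r → H) (cs : Fin r → ((H →ₐ[k] k) → Module.End k M)),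
        (∀ i, MemCend k H A ΔA M (cs i)) ∧
        ∀ g gi : H →ₐ[k] k, (∀ h : H, gi h = g (HopfAlgebra.antipode (R := k) h)) →
          ∀ z : H →ₐ[k] k,
            compCendM k H M g gi a b z = ∑ i, g (hs i) • cs i z)) ∧
    (∀ a b c : (H →ₐ[k] k) → Module.End k M,
      MemCend k H A ΔA M a → MemCend k H A ΔA M b → MemCend k H A ΔA M c →
      ∀ g γ gi γi gγi : H →ₐ[k] k,
        (∀ h : H, gi h = g (HopfAlgebra.antipode (R := k) h)) →
        (∀ h : H, γi h = γ (HopfAlgebra.antipode (R := k) h)) →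
        (∀ h : H, gγi h = conv k H γ g (HopfAlgebra.antipode (R := k) h)) →
        compCendM k H M g gi a (compCendM k H M γ γi b c) =
          compCendM k H M (conv k H γ g) gγi (compCendM k H M g gi a b) c) := by
  refine ⟨fun a b ha hb => ⟨fun g gi hg => ha.compCendM hcoassoc hb hg, ?_⟩, ?_⟩
  · obtain ⟨S, hS⟩ := Module.Finite.fg_top (R := A) (M := M)
    choose T hT hF using fun u : M => isUniformlyRegular_comp ha.1 hb.1 u
    obtain ⟨r, p, φ, hφ⟩ := exists_interpolation_regularFun (M := M)
      (Submodule.fg_biSup S T fun u _ => hT u)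
    let inv (g : H →ₐ[k] k) := g.comp (HopfAlgebra.antipodeAlgHom k H)
    have hc (i : Fin r) : MemCend k H A ΔA M (compCendM k H M (p i) (inv (p i)) a b) :=
      ha.compCendM hcoassoc hb fun _ => rfl
    refine ⟨r, φ, fun i => compCendM k H M (p i) (inv (p i)) a b, hc, fun g gi hg z => ?_⟩
    obtain rfl : gi = inv g := AlgHom.ext hg
    have hab := ha.compCendM hcoassoc hb hg
    ext u
    simp only [LinearMap.sum_apply, LinearMap.smul_apply]
    have hu : u ∈ Submodule.span A (S : Set M) := hS ▸ Submodule.mem_top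
    induction hu using Submodule.span_induction with
    | mem u hu => exact hφ _ (regularFun_mono (le_biSup T hu) (hF u z)) g
    | zero => simp
    | add u v _ _ h₁ h₂ => simp only [map_add, smul_add, Finset.sum_add_distrib, h₁, h₂]
    | smul f u _ h =>
      rw [hab.2, h, Finset.smul_sum]
      exact Finset.sum_congr rfl fun i _ => by rw [(hc i).2, smul_algebra_smul_comm]
  · intro a b c _ _ _ g γ gi γi gγi hg hγ hgγ
    have h₁ : conv k H (conv k H γ g) gi = γ := by
      apply WithConv.toConv_injective
      simp [toConv_conv, toConv_eq_inv hg]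
    have h₂ (z : H →ₐ[k] k) : conv k H (conv k H z gi) γi = conv k H z gγi := by
      apply WithConv.toConv_injective
      simp [toConv_conv, toConv_eq_inv hg, toConv_eq_inv hγ, toConv_eq_inv hgγ, mul_assoc]
    funext z
    simp only [compCendM, h₁, h₂, LinearMap.comp_assoc]

end
end

section
/- Let g₁,…,g_m ∈ G (m ≥ 1) be pairwise distinct and let u ∈ H be nonzero (so the basic open set U = {z ∈ G : u(z) ≠ 0} is nonempty). Then there exist f₁,…,f_m ∈ H and a point z ∈ G with u(z) ≠ 0 such that the m×m determinant det( (L_{g_i} f_j)(z) )_{i,j=1,…,m} is nonzero. -/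
open TensorProduct

noncomputable section

/-- The left shift `L_g : H → H`, `L_g h = Σ h₍₁₎(g) · h₍₂₎`. -/
def lshift (k : Type) [Field k] (H : Type) [CommRing H] [HopfAlgebra k H]
    (g : H →ₐ[k] k) : H →ₗ[k] H :=
  (TensorProduct.lid k H).toLinearMap ∘ₗ
    (TensorProduct.map g.toLinearMap LinearMap.id) ∘ₗ Coalgebra.comul

/-- Weak Nullstellensatz: a nonzero element of a reduced finitely generated algebra over an
algebraically closed field is nonzero at some rational point. -/
theorem exists_algHom_apply_ne_zero {k H : Type*} [Field k] [IsAlgClosed k] [CommRing H]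
    [Algebra k H] [Algebra.FiniteType k H] [IsReduced H] {u : H} (hu : u ≠ 0) :
    ∃ z : H →ₐ[k] k, z u ≠ 0 := by
  have : Nontrivial (Localization.Away u) := by
    rw [← not_subsingleton_iff_nontrivial,
      IsLocalization.subsingleton_iff (M := Submonoid.powers u)]
    rintro ⟨n, hn⟩
    exact hu (eq_zero_of_pow_eq_zero hn)
  have : Algebra.FiniteType k (Localization.Away u) :=
    have := IsLocalization.finiteType_of_monoid_fg (Submonoid.powers u) (Localization.Away u)
    .trans (S := H) ‹_› this
  obtain ⟨M, hM⟩ := Ideal.exists_maximal (Localization.Away u)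
  let := Ideal.Quotient.field M
  have := finite_of_finite_type_of_isJacobsonRing k (Localization.Away u ⧸ M)
  let e := AlgEquiv.ofBijective (Algebra.ofId k (Localization.Away u ⧸ M))
    IsAlgClosed.algebraMap_bijective_of_isIntegral
  refine ⟨(e.symm.toAlgHom.comp (Ideal.Quotient.mkₐ k M)).comp
    (IsScalarTower.toAlgHom k H (Localization.Away u)), ?_⟩
  exact ((IsLocalization.Away.algebraMap_isUnit u).map
    (e.symm.toAlgHom.comp (Ideal.Quotient.mkₐ k M))).ne_zero

/-- Pairwise distinct rational points can be separated by functions whose evaluation matrix is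
invertible. -/
theorem exists_det_algHom_apply_ne_zero {k H ι : Type*} [Field k] [CommRing H] [Algebra k H]
    [Fintype ι] [DecidableEq ι] {p : ι → H →ₐ[k] k} (hp : Function.Injective p) :
    ∃ f : ι → H, (Matrix.of fun i j => p i (f j)).det ≠ 0 := by
  have hsep : ∀ i j, ∃ a, i ≠ j → p i a ≠ p j a := fun i j ↦ by
    by_cases h : i = j
    · exact ⟨0, fun h' ↦ absurd h h'⟩
    · exact (DFunLike.ne_iff.mp (hp.ne h)).imp fun _ ha _ ↦ ha
  choose a ha using hsep
  refine ⟨fun j ↦ ∏ i ∈ Finset.univ.erase j, (a i j - algebraMap k H (p i (a i j))), ?_⟩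
  have hdiag : (Matrix.of fun i j => p i (∏ l ∈ Finset.univ.erase j,
      (a l j - algebraMap k H (p l (a l j))))) = Matrix.diagonal fun j ↦
        ∏ l ∈ Finset.univ.erase j, (p j (a l j) - p l (a l j)) := by
    ext i j
    by_cases h : i = j
    · subst h
      simp [map_prod]
    · rw [Matrix.diagonal_apply_ne _ h, Matrix.of_apply, map_prod]
      exact Finset.prod_eq_zero (Finset.mem_erase.mpr ⟨h, Finset.mem_univ i⟩) (by simp)
  rw [hdiag, Matrix.det_diagonal]
  refine Finset.prod_ne_zero_iff.mpr fun j _ ↦ Finset.prod_ne_zero_iff.mpr fun l hl ↦ ?_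
  exact sub_ne_zero.mpr (ha l j (Finset.ne_of_mem_erase hl)).symm

/-- Evaluating a left shift by `g` at `z` is evaluating at the convolution product `g * z`. -/
theorem algHom_lshift {k H : Type} [Field k] [CommRing H] [HopfAlgebra k H]
    (g z : H →ₐ[k] k) (h : H) :
    z (lshift k H g h) = (WithConv.toConv g * WithConv.toConv z) h := by
  have key : z.toLinearMap ∘ₗ (TensorProduct.lid k H).toLinearMap ∘ₗ
      TensorProduct.map g.toLinearMap LinearMap.id =
      (Algebra.TensorProduct.lift g z fun _ _ ↦ .all ..).toLinearMap := by
    ext x y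
    simp
  rw [AlgHom.convMul_apply]
  exact LinearMap.congr_fun key (Coalgebra.comul h)

/-- Let `g₁,…,g_m ∈ G` be pairwise distinct and `u ∈ H` nonzero. Then there exist
`f₁,…,f_m ∈ H` and a point `z ∈ G` with `u(z) ≠ 0` such that
`det((L_{gᵢ} f_j)(z)) ≠ 0`. -/
theorem stmt8 (k : Type) [Field k] [IsAlgClosed k] [CharZero k]
    (H : Type) [CommRing H] [HopfAlgebra k H] [Algebra.FiniteType k H] [IsReduced H]
    (m : ℕ) (hm : 1 ≤ m) (g : Fin m → (H →ₐ[k] k)) (hg : Function.Injective g)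
    (u : H) (hu : u ≠ 0) :
    ∃ (f : Fin m → H) (z : H →ₐ[k] k), z u ≠ 0 ∧
      (Matrix.of fun i j : Fin m => z (lshift k H (g i) (f j))).det ≠ 0 := by
  obtain ⟨z, hz⟩ := exists_algHom_apply_ne_zero (k := k) hu
  have hp : Function.Injective fun i ↦ (WithConv.toConv (g i) * WithConv.toConv z).ofConv :=
    fun i j hij ↦ hg (WithConv.toConv_injective (mul_right_cancel (WithConv.ofConv_injective hij)))
  obtain ⟨f, hf⟩ := exists_det_algHom_apply_ne_zero hp
  refine ⟨f, z, hz, ?_⟩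
  simp only [algHom_lshift]
  exact hf

end
end

section
/- Every φ ∈ End_k M satisfying φ∘α = α∘φ for all α ∈ S is H-linear, i.e. φ∘μ_h = μ_h∘φ for all h ∈ H; in other words, the centralizer End_S M is contained in End_H M. -/
noncomputable section

/-- For `h ∈ H`, the operator `μ_h ∈ End_k M` of multiplication by `h`. -/
def muH (k : Type) [Field k] (H : Type) [CommRing H] [Algebra k H]
    (M : Type) [AddCommGroup M] [Module H M] [Module k M] [IsScalarTower k H M]
    (h : H) : Module.End k M where
  toFun m := h • m
  map_add' := smul_add h
  map_smul' c m := by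
    simp only [RingHom.id_apply]
    rw [← algebraMap_smul H c m, ← algebraMap_smul H c (h • m), smul_smul, smul_smul,
      mul_comm]

/-- Every `φ ∈ End_k M` commuting with all of `S` is `H`-linear:
the centralizer `End_S M` is contained in `End_H M`. -/
theorem stmt12 (k : Type) [Field k] (H : Type) [CommRing H] [Algebra k H]
    (M : Type) [AddCommGroup M] [Module H M] [Module k M] [IsScalarTower k H M]
    (S : Submodule k (Module.End k M))
    (hSmul : ∀ α ∈ S, ∀ β ∈ S, α * β ∈ S)
    (hSM : ∃ α ∈ S, ∃ u : M, α u ≠ 0)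
    (hirr : ∀ U : Submodule k M, (∀ α ∈ S, ∀ u ∈ U, α u ∈ U) → U = ⊥ ∨ U = ⊤)
    (hHS : ∀ h : H, ∀ α ∈ S, muH k H M h * α ∈ S ∧ α * muH k H M h ∈ S)
    (φ : Module.End k M) (hφ : ∀ α ∈ S, φ * α = α * φ) :
    ∀ h : H, φ * muH k H M h = muH k H M h * φ := by
  intro h
  have hrange : ∀ α ∈ S, ∀ m, α m ∈ LinearMap.ker (φ * muH k H M h - muH k H M h * φ) := by
    intro α hα m
    have h₁ := LinearMap.congr_fun (hφ _ (hHS h α hα).1) m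
    have h₂ := LinearMap.congr_fun (hφ α hα) m
    simp only [Module.End.mul_apply] at h₁ h₂
    simp [h₁, h₂]
  rcases hirr _ fun α hα u _ => hrange α hα u with hU | hU
  · obtain ⟨α, hα, u, hu⟩ := hSM
    have hm := hrange α hα u
    rw [hU] at hm
    exact absurd hm hu
  · exact sub_eq_zero.mp (LinearMap.ker_eq_top.mp hU)

end
end

section
/- If D is a k-subalgebra of Mat_n(H) containing the identity matrix E such that every nonzero element of D has a two-sided multiplicative inverse belonging to D (i.e. D is a division algebra), then D = k·E. -/
/-- If `D` is a `k`-subalgebra of `Mat_n(H)` (containing the identity matrix) in which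
every nonzero element has a two-sided inverse belonging to `D`, then `D = k·E`. -/
theorem stmt13 (k : Type) [Field k] [IsAlgClosed k]
    (n : ℕ) (hn : 1 ≤ n)
    (H : Type) [CommRing H] [Algebra k H] (ev : H →ₐ[k] k)
    (D : Subalgebra k (Matrix (Fin n) (Fin n) H))
    (hdiv : ∀ x ∈ D, x ≠ 0 → ∃ y ∈ D, x * y = 1 ∧ y * x = 1) :
    D = ⊥ := by
  have : Nonempty (Fin n) := ⟨⟨0, hn⟩⟩
  refine eq_bot_iff.2 fun x hx => ?_
  obtain ⟨c, hc⟩ := spectrum.nonempty_of_isAlgClosed_of_finiteDimensional k (ev.mapMatrix x)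
  have hxc : algebraMap k _ c - x = 0 := by
    by_contra hne
    obtain ⟨y, -, hxy, hyx⟩ := hdiv _ (D.sub_mem (D.algebraMap_mem c) hx) hne
    have hunit : IsUnit (algebraMap k (Matrix (Fin n) (Fin n) H) c - x) := ⟨⟨_, y, hxy, hyx⟩, rfl⟩
    apply spectrum.mem_iff.1 hc
    simpa only [map_sub, AlgHom.commutes] using hunit.map ev.mapMatrix
  exact Algebra.mem_bot.2 ⟨c, sub_eq_zero.1 hxc⟩
end

section
/- S is a dense subalgebra of End_k M with respect to the finite topology: for every finite k-linearly independent family u₁,…,u_m ∈ M and arbitrary elements v₁,…,v_m ∈ M there exists α ∈ S with α(uᵢ) = vᵢ for all i = 1,…,m. -/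
noncomputable section

section Density

variable {k M : Type} [Field k] [AddCommGroup M] [Module k M]

theorem span_range_eq_top (S : Submodule k (Module.End k M))
    (hSM : ∃ α ∈ S, ∃ u : M, α u ≠ 0)
    (hirr : ∀ U : Submodule k M, (∀ α ∈ S, ∀ u ∈ U, α u ∈ U) → U = ⊥ ∨ U = ⊤) :
    Submodule.span k {x : M | ∃ α ∈ S, ∃ u, α u = x} = ⊤ := by
  rcases hirr (Submodule.span k {x : M | ∃ α ∈ S, ∃ u, α u = x})
    (fun α hα u _ => Submodule.subset_span ⟨α, hα, u, rfl⟩) with h | h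
  · obtain ⟨α, hα, u, hu⟩ := hSM
    exact absurd ((Submodule.mem_bot k).1 (h ▸ Submodule.subset_span ⟨α, hα, u, rfl⟩)) hu
  · exact h

theorem eq_zero_of_forall_apply_eq_zero (S : Submodule k (Module.End k M))
    (hSM : ∃ α ∈ S, ∃ u : M, α u ≠ 0)
    (hirr : ∀ U : Submodule k M, (∀ α ∈ S, ∀ u ∈ U, α u ∈ U) → U = ⊥ ∨ U = ⊤)
    (x : M) (hx : ∀ α ∈ S, α x = 0) : x = 0 := by
  let U : Submodule k M :=
    { carrier := {y | ∀ α ∈ S, α y = 0}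
      zero_mem' := fun α _ => map_zero α
      add_mem' := fun {a b} ha hb α hα => by rw [map_add, ha α hα, hb α hα, add_zero]
      smul_mem' := fun c y hy α hα => by rw [map_smul, hy α hα, smul_zero] }
  have hxU : x ∈ U := hx
  rcases hirr U (fun α hα u hu => by rw [hu α hα]; exact U.zero_mem) with h | h
  · rwa [h, Submodule.mem_bot] at hxU
  · obtain ⟨α, hα, u, hu⟩ := hSM
    have huU : u ∈ U := h ▸ Submodule.mem_top
    exact absurd (huU α hα) hu

/-- A nonzero operator in the commutant of an irreducible space of operators is bijective. -/
theorem bijective_of_commute (S : Submodule k (Module.End k M))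
    (hirr : ∀ U : Submodule k M, (∀ α ∈ S, ∀ u ∈ U, α u ∈ U) → U = ⊥ ∨ U = ⊤)
    (f : Module.End k M) (hf : ∀ α ∈ S, ∀ x, f (α x) = α (f x)) (h0 : f ≠ 0) :
    Function.Bijective f := by
  constructor
  · rcases hirr (LinearMap.ker f) (fun α hα u hu => by
      rw [LinearMap.mem_ker] at hu ⊢
      rw [hf α hα, hu, map_zero]) with h | h
    · exact LinearMap.ker_eq_bot.1 h
    · exact absurd (LinearMap.ker_eq_top.1 h) h0
  · rcases hirr (LinearMap.range f) (fun α hα u hu => by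
      obtain ⟨y, rfl⟩ := hu
      exact ⟨α y, hf α hα y⟩) with h | h
    · exact absurd (LinearMap.range_eq_bot.1 h) h0
    · exact LinearMap.range_eq_top.1 h

/-- The Jacobson density theorem for an irreducible space of operators, closed under composition,
whose commutant consists of scalars. -/
theorem exists_apply_eq_of_commutant_scalar (S : Submodule k (Module.End k M))
    (hSmul : ∀ α ∈ S, ∀ β ∈ S, α * β ∈ S)
    (hSM : ∃ α ∈ S, ∃ u : M, α u ≠ 0)
    (hirr : ∀ U : Submodule k M, (∀ α ∈ S, ∀ u ∈ U, α u ∈ U) → U = ⊥ ∨ U = ⊤)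
    (hschur : ∀ f : Module.End k M, (∀ α ∈ S, ∀ x, f (α x) = α (f x)) →
      ∃ c : k, ∀ x, f x = c • x)
    (m : ℕ) (u : Fin m → M) (hu : LinearIndependent k u) (v : Fin m → M) :
    ∃ α ∈ S, ∀ i, α (u i) = v i := by
  induction m with
  | zero => exact ⟨0, S.zero_mem, fun i => i.elim0⟩
  | succ m ih =>
    rw [linearIndependent_finSucc] at hu
    obtain ⟨hu', hw⟩ := hu
    replace ih := ih (Fin.tail u) hu'
    have key : ∃ α ∈ S, (∀ i, α (Fin.tail u i) = 0) ∧ α (u 0) ≠ 0 := by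
      by_contra! hcon
      choose g hgS hg using ih
      have hfi : ∀ i : Fin m, ∃ c : k, ∀ y, g (Pi.single i y) (u 0) = c • y := by
        intro i
        let f : Module.End k M :=
          { toFun := fun y => g (Pi.single i y) (u 0)
            map_add' := fun a b => by
              have := hcon (g (Pi.single i (a + b)) - (g (Pi.single i a) + g (Pi.single i b)))
                (S.sub_mem (hgS _) (S.add_mem (hgS _) (hgS _)))
                (fun j => by simp [hg, Pi.single_add])
              simpa [sub_eq_zero] using this
            map_smul' := fun c a => by
              have := hcon (g (Pi.single i (c • a)) - c • g (Pi.single i a))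
                (S.sub_mem (hgS _) (S.smul_mem _ (hgS _)))
                (fun j => by simp [hg, Pi.single_smul])
              simpa [sub_eq_zero] using this }
        refine hschur f fun α hα y => ?_
        have := hcon (g (Pi.single i (α y)) - α * g (Pi.single i y))
          (S.sub_mem (hgS _) (hSmul _ hα _ (hgS _)))
          (fun j => by
            simp only [LinearMap.sub_apply, Module.End.mul_apply, hg]
            rcases eq_or_ne j i with rfl | hji
            · simp
            · simp [hji])
        exact sub_eq_zero.1 this
      choose c hc using hfi
      have hz : u 0 - ∑ i, c i • Fin.tail u i = 0 := by
        refine eq_zero_of_forall_apply_eq_zero S hSM hirr _ fun α hα => ?_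
        have := hcon (α - ∑ i, g (Pi.single i (α (Fin.tail u i))))
          (S.sub_mem hα (S.sum_mem fun i _ => hgS _))
          (fun j => by
            simp only [LinearMap.sub_apply, LinearMap.sum_apply, hg]
            rw [← Finset.sum_apply, Finset.univ_sum_single, sub_self])
        simpa [hc, LinearMap.sum_apply] using this
      apply hw
      rw [sub_eq_zero.1 hz]
      exact Submodule.sum_mem _ fun i _ =>
        Submodule.smul_mem _ _ (Submodule.subset_span ⟨i, rfl⟩)
    let U : Submodule k M :=
      { carrier := {y | ∃ α ∈ S, (∀ i, α (Fin.tail u i) = 0) ∧ α (u 0) = y}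
        zero_mem' := ⟨0, S.zero_mem, fun _ => rfl, rfl⟩
        add_mem' := by
          rintro _ _ ⟨α, hα, hα0, rfl⟩ ⟨β, hβ, hβ0, rfl⟩
          exact ⟨α + β, S.add_mem hα hβ, fun i => by simp [hα0, hβ0], rfl⟩
        smul_mem' := by
          rintro c _ ⟨α, hα, hα0, rfl⟩
          exact ⟨c • α, S.smul_mem c hα, fun i => by simp [hα0], rfl⟩ }
    have hU : U = ⊤ := by
      refine (hirr U ?_).resolve_left ?_
      · rintro β hβ _ ⟨α, hα, hα0, rfl⟩
        exact ⟨β * α, hSmul _ hβ _ hα, fun i => by simp [hα0], rfl⟩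
      · intro h
        obtain ⟨α, hα, hα0, hne⟩ := key
        have hmem : α (u 0) ∈ U := ⟨α, hα, hα0, rfl⟩
        rw [h] at hmem
        exact hne ((Submodule.mem_bot k).1 hmem)
    obtain ⟨β, hβ, hβv⟩ := ih (Fin.tail v)
    obtain ⟨α, hα, hα0, hαv⟩ : v 0 - β (u 0) ∈ U := hU ▸ Submodule.mem_top
    refine ⟨α + β, S.add_mem hα hβ, fun i => ?_⟩
    refine Fin.cases ?_ (fun i => ?_) i
    · simp [hαv]
    · have h1 := hα0 i
      have h2 := hβv i
      simp only [Fin.tail] at h1 h2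
      simp [h1, h2]

end Density

/-- Every `H`-linear endomorphism of `Hⁿ`, `n ≥ 1`, becomes non-bijective after subtracting it from
a suitable scalar of `k`, if `H` has a `k`-point. -/
theorem exists_not_bijective_smul_sub {k H : Type} [Field k] [IsAlgClosed k] [CommRing H]
    [Algebra k H] (ev : H →ₐ[k] k) {n : ℕ} (hn : 1 ≤ n) (f : (Fin n → H) →ₗ[H] (Fin n → H)) :
    ∃ c : k, ¬ Function.Bijective fun x => c • x - f x := by
  let A := LinearMap.toMatrix' f
  have hdeg : (A.map ev).charpoly.degree ≠ 0 := by
    rw [Matrix.charpoly_degree_eq_dim, Fintype.card_fin]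
    exact_mod_cast (by omega : n ≠ 0)
  obtain ⟨c, hc⟩ := IsAlgClosed.exists_root _ hdeg
  refine ⟨c, fun hbij => ?_⟩
  let g : (Fin n → H) →ₗ[H] (Fin n → H) := algebraMap k H c • LinearMap.id - f
  have hg : Function.Bijective g := by
    convert hbij using 2 with x
    simp [g, algebraMap_smul]
  have hunit : IsUnit (LinearMap.det g) :=
    LinearEquiv.isUnit_det' (LinearEquiv.ofBijective g hg)
  have hmat : (LinearMap.toMatrix' g).map ev = Matrix.scalar (Fin n) c - A.map ev := by
    ext i j
    rcases eq_or_ne i j with rfl | hij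
    · simp [g, A]
    · simp [g, A, hij]
  have hdet : ev (LinearMap.det g) = 0 := by
    rw [← LinearMap.det_toMatrix', AlgHom.map_det, AlgHom.mapMatrix_apply, hmat,
      ← Matrix.eval_charpoly]
    exact hc
  exact (hdet ▸ hunit.map ev).ne_zero rfl

/-- `S` is a dense subalgebra of `End_k M` for `M = Hⁿ`: for every finite `k`-linearly
independent family `u₁,…,u_m ∈ M` and arbitrary `v₁,…,v_m ∈ M` there exists `α ∈ S`
with `α(uᵢ) = vᵢ` for all `i`. -/
theorem stmt14 (k : Type) [Field k] [IsAlgClosed k]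
    (H : Type) [CommRing H] [Algebra k H] (hev : Nonempty (H →ₐ[k] k))
    (n : ℕ) (hn : 1 ≤ n)
    (S : Submodule k (Module.End k (Fin n → H)))
    (hSmul : ∀ α ∈ S, ∀ β ∈ S, α * β ∈ S)
    (hSM : ∃ α ∈ S, ∃ u : Fin n → H, α u ≠ 0)
    (hirr : ∀ U : Submodule k (Fin n → H),
      (∀ α ∈ S, ∀ u ∈ U, α u ∈ U) → U = ⊥ ∨ U = ⊤)
    (hHS : ∀ h : H, ∀ α ∈ S,
      muH k H (Fin n → H) h * α ∈ S ∧ α * muH k H (Fin n → H) h ∈ S)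
    (m : ℕ) (u : Fin m → (Fin n → H)) (hu : LinearIndependent k u)
    (v : Fin m → (Fin n → H)) :
    ∃ α ∈ S, ∀ i, α (u i) = v i := by
  obtain ⟨ev⟩ := hev
  refine exists_apply_eq_of_commutant_scalar S hSmul hSM hirr (fun f hf => ?_) m u hu v
  have hlin : ∀ (h : H) (x : Fin n → H), f (h • x) = h • f x := by
    intro h x
    have hx : x ∈ Submodule.span k {x : Fin n → H | ∃ α ∈ S, ∃ u, α u = x} :=
      span_range_eq_top S hSM hirr ▸ Submodule.mem_top
    induction hx using Submodule.span_induction with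
    | mem x hx =>
      obtain ⟨α, hα, y, rfl⟩ := hx
      have := hf _ (hHS h α hα).1 y
      rw [hf α hα]
      exact this
    | zero => simp
    | add x y _ _ hx hy => rw [smul_add, map_add, map_add, hx, hy, smul_add]
    | smul c x _ hx => rw [smul_comm, f.map_smul, f.map_smul, hx, smul_comm]
  obtain ⟨c, hc⟩ := exists_not_bijective_smul_sub ev hn
    { toFun := f, map_add' := map_add f, map_smul' := hlin }
  refine ⟨c, fun x => ?_⟩
  have hzero : c • (1 : Module.End k (Fin n → H)) - f = 0 := by
    by_contra hne
    exact hc (bijective_of_commute S hirr _ (fun α hα x => by simp [hf α hα]) hne)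
  exact (sub_eq_zero.1 (LinearMap.congr_fun hzero x)).symm

end
end
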